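/- arXiv:1112.2326 — 2 statements merged into one kernel-verified Lean document; each statement's English description precedes it below -/
import Mathlib

section
/- If G is a finite simple connected graph of order n whose girth g satisfies g ≥ 5, then β(G) ≤ n − δ(G), where δ(G) is the minimum degree of G. -/
open SimpleGraph Finset

variable {V : Type*}

/-- `Γ` is a dominating set for `G`: every vertex not in `Γ` has a neighbor in `Γ`. -/
def IsDominatingSet (G : SimpleGraph V) (Γ : Finset V) : Prop :=
  ∀ v : V, v ∉ Γ → ∃ u ∈ Γ, G.Adj v u

/-- The domination number `γ(G)`: the minimum cardinality of a dominating set. -/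
noncomputable def dominationNumber (G : SimpleGraph V) [Fintype V] : ℕ :=
  sInf {k | ∃ Γ : Finset V, IsDominatingSet G Γ ∧ Γ.card = k}

/-- `W` is a resolving set for `G`: any two distinct vertices are distinguished by their
distance to some vertex of `W`. -/
def IsResolvingSet (G : SimpleGraph V) (W : Finset V) : Prop :=
  ∀ u v : V, u ≠ v → ∃ w ∈ W, G.dist u w ≠ G.dist v w

/-- The metric dimension `β(G)`: the minimum cardinality of a resolving set. -/
noncomputable def metricDimension (G : SimpleGraph V) [Fintype V] : ℕ :=
  sInf {k | ∃ W : Finset V, IsResolvingSet G W ∧ W.card = k}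

theorem no_triangle_aux (G : SimpleGraph V) (hg : 5 ≤ G.egirth) {a b c : V}
    (h1 : G.Adj a b) (h2 : G.Adj b c) (h3 : G.Adj c a) : False := by
  have hc : (Walk.cons h1 (Walk.cons h2 (Walk.cons h3 Walk.nil))).IsCycle := by
    have := h1.ne
    have := h2.ne
    have := h3.ne
    rw [Walk.cons_isCycle_iff]
    simp [Walk.isPath_def]
    grind
  have := le_egirth.1 hg _ _ hc
  simp at this
  norm_cast at this

theorem no_square_aux (G : SimpleGraph V) (hg : 5 ≤ G.egirth) {a b c d : V}
    (h1 : G.Adj a b) (h2 : G.Adj b c) (h3 : G.Adj c d) (h4 : G.Adj d a)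
    (hac : a ≠ c) (hbd : b ≠ d) : False := by
  have hc : (Walk.cons h1 (Walk.cons h2 (Walk.cons h3 (Walk.cons h4 Walk.nil)))).IsCycle := by
    have := h1.ne
    have := h2.ne
    have := h3.ne
    have := h4.ne
    rw [Walk.cons_isCycle_iff]
    simp [Walk.isPath_def]
    grind
  have := le_egirth.1 hg _ _ hc
  simp at this
  norm_cast at this

/-- If `G` is connected of order `n` with girth at least `5`, then
`β(G) ≤ n - δ(G)`. -/
theorem metricDimension_le_card_sub_minDegree_of_five_le_girth [Fintype V]
    (G : SimpleGraph V) [DecidableRel G.Adj] (hG : G.Connected) (hg : 5 ≤ G.egirth) :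
    metricDimension G ≤ Fintype.card V - G.minDegree := by
  classical
  have key : ∀ S : Finset V, G.minDegree ≤ S.card →
      (∀ a ∈ S, ∀ b ∈ S, a ≠ b → ∃ w, w ∉ S ∧ G.dist a w ≠ G.dist b w) →
      metricDimension G ≤ Fintype.card V - G.minDegree := by
    intro S hS h
    have h1 : metricDimension G ≤ (Sᶜ).card := by
      apply Nat.sInf_le
      refine ⟨Sᶜ, ?_, rfl⟩
      intro u v huv
      by_cases hu : u ∈ S
      · by_cases hv : v ∈ S
        · obtain ⟨w, hw, hd⟩ := h u hu v hv huv
          exact ⟨w, by simpa using hw, hd⟩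
        · refine ⟨v, by simpa using hv, ?_⟩
          have := hG.pos_dist_of_ne huv
          simp only [SimpleGraph.dist_self]
          omega
      · refine ⟨u, by simpa using hu, ?_⟩
        have := hG.pos_dist_of_ne huv.symm
        simp only [SimpleGraph.dist_self]
        omega
    rw [Finset.card_compl] at h1
    omega
  obtain ⟨v⟩ := hG.nonempty
  by_cases hd : G.minDegree ≤ 1
  · refine key {v} (by simpa using hd) ?_
    intro a ha b hb hab
    simp only [Finset.mem_singleton] at ha hb
    exact absurd (ha.trans hb.symm) hab
  · refine key (G.neighborFinset v) (by simpa using G.minDegree_le_degree v) ?_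
    intro a ha b hb hab
    rw [mem_neighborFinset] at ha hb
    have h2 : 1 < (G.neighborFinset a).card := by
      have := G.minDegree_le_degree a
      rw [card_neighborFinset_eq_degree]
      omega
    obtain ⟨w, hw, hwv⟩ := Finset.exists_mem_ne h2 v
    rw [mem_neighborFinset] at hw
    refine ⟨w, ?_, ?_⟩
    · rw [mem_neighborFinset]
      intro hvw
      exact no_triangle_aux G hg ha hw hvw.symm
    · rw [SimpleGraph.dist_eq_one_iff_adj.2 hw]
      intro h
      have hbw := SimpleGraph.dist_eq_one_iff_adj.1 h.symm
      exact no_square_aux G hg ha hw hbw.symm hb.symm hwv.symm hab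
end

section
/- Let G be a finite simple connected graph of order n with degree sequence (d_1, d_2, …, d_n) where d_i ≥ d_{i+1} for all i. Then β(G) ≤ n − min{k : k + (d_1 + d_2 + ⋯ + d_k) ≥ n}. -/
open SimpleGraph Finset

variable {V : Type*}

theorem sum_le_sum_range_card (n : ℕ) (d : ℕ → ℕ)
    (hd : ∀ i j : ℕ, i ≤ j → j < n → d j ≤ d i) (S : Finset ℕ) :
    (∀ x ∈ S, x < n) → ∑ i ∈ S, d i ≤ ∑ i ∈ Finset.range S.card, d i := by
  induction S using Finset.induction_on_max with
  | empty => simp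
  | insert a s hs ih =>
    intro h
    have ha : a ∉ s := fun h => lt_irrefl _ (hs a h)
    have hc : s.card ≤ a := by
      have : s ⊆ Finset.range a := fun x hx => Finset.mem_range.2 (hs x hx)
      simpa using Finset.card_le_card this
    rw [Finset.sum_insert ha, Finset.card_insert_of_notMem ha, Finset.sum_range_succ]
    have h1 := ih (fun x hx => h x (Finset.mem_insert_of_mem hx))
    have h2 := hd _ _ hc (h a (Finset.mem_insert_self _ _))
    omega

theorem card_le_of_dominating [Fintype V] (G : SimpleGraph V) [DecidableRel G.Adj] (d : ℕ → ℕ)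
    (hsorted : ∀ i j : ℕ, i ≤ j → j < Fintype.card V → d j ≤ d i)
    (hdeg : ∃ σ : Fin (Fintype.card V) ≃ V, ∀ i : Fin (Fintype.card V), d i = G.degree (σ i))
    (Γ : Finset V) (h : IsDominatingSet G Γ) :
    Fintype.card V ≤ Γ.card + ∑ i ∈ Finset.range Γ.card, d i := by
  classical
  obtain ⟨σ, hσ⟩ := hdeg
  have h1 : (Finset.univ : Finset V) ⊆ Γ ∪ Γ.biUnion (fun v => G.neighborFinset v) := by
    intro v _
    by_cases hv : v ∈ Γ
    · simp [hv]
    · obtain ⟨u, hu, huv⟩ := h v hv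
      simp only [Finset.mem_union, Finset.mem_biUnion, mem_neighborFinset]
      exact Or.inr ⟨u, hu, huv.symm⟩
  have h2 := Finset.card_le_card h1
  have h3 := Finset.card_union_le Γ (Γ.biUnion (fun v => G.neighborFinset v))
  have h4 : (Γ.biUnion (fun v => G.neighborFinset v)).card ≤ ∑ v ∈ Γ, G.degree v :=
    Finset.card_biUnion_le
  have hinj : Function.Injective (fun v : V => ((σ.symm v : Fin _) : ℕ)) :=
    Fin.val_injective.comp σ.symm.injective
  have h5 := sum_le_sum_range_card (Fintype.card V) d hsorted
    (Γ.image (fun v : V => ((σ.symm v : Fin _) : ℕ))) (by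
      intro x hx
      obtain ⟨v, _, rfl⟩ := Finset.mem_image.1 hx
      exact (σ.symm v).2)
  rw [Finset.sum_image hinj.injOn, Finset.card_image_of_injective _ hinj] at h5
  have h6 : ∀ v, d ((σ.symm v : Fin _) : ℕ) = G.degree v := by
    intro v
    have h7 : σ (σ.symm v) = v := σ.apply_symm_apply v
    rw [hσ]
    exact congrArg (fun x => G.degree x) h7
  simp only [h6] at h5
  rw [Finset.card_univ] at h2
  omega

/-- A minimum dominating set in which every member has an external private neighbour. -/
theorem exists_dominating_private [Fintype V] (G : SimpleGraph V)
    (hnb : ∀ v, ∃ w, G.Adj v w) :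
    ∃ Γ : Finset V, IsDominatingSet G Γ ∧
      ∀ v ∈ Γ, ∃ w, w ∉ Γ ∧ G.Adj w v ∧ ∀ u ∈ Γ, G.Adj w u → u = v := by
  classical
  let D : Finset (Finset V) := Finset.univ.filter (fun Γ => IsDominatingSet G Γ)
  have hD : D.Nonempty := ⟨Finset.univ, Finset.mem_filter.2
    ⟨Finset.mem_univ _, fun v hv => absurd (Finset.mem_univ v) hv⟩⟩
  obtain ⟨Γ₀, hΓ₀, hmin⟩ := Finset.exists_min_image D Finset.card hD
  let P : Finset V → Finset V := fun Γ => Γ.filter (fun x => ∃ u ∈ Γ, G.Adj x u)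
  obtain ⟨Γ, hΓ, hmax⟩ := Finset.exists_max_image (D.filter (fun Γ => Γ.card = Γ₀.card))
    (fun Γ => (P Γ).card) ⟨Γ₀, by simp [hΓ₀]⟩
  simp only [Finset.mem_filter, D, Finset.mem_univ, true_and] at hΓ hmin hmax
  obtain ⟨hdom, hcard⟩ := hΓ
  refine ⟨Γ, hdom, fun v hv => ?_⟩
  by_contra hno
  push Not at hno
  have hpos : 0 < Γ.card := Finset.card_pos.2 ⟨v, hv⟩
  have hiso : ∀ u ∈ Γ, ¬ G.Adj v u := by
    intro u hu huv
    have hdom' : IsDominatingSet G (Γ.erase v) := by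
      intro x hx
      by_cases hxv : x = v
      · subst hxv
        exact ⟨u, Finset.mem_erase.2 ⟨huv.ne', hu⟩, huv⟩
      · have hx' : x ∉ Γ := fun h => hx (Finset.mem_erase.2 ⟨hxv, h⟩)
        obtain ⟨y, hy, hxy⟩ := hdom x hx'
        by_cases hyv : y = v
        · subst hyv
          obtain ⟨z, hz, hxz, hzy⟩ := hno x hx' hxy
          exact ⟨z, Finset.mem_erase.2 ⟨hzy, hz⟩, hxz⟩
        · exact ⟨y, Finset.mem_erase.2 ⟨hyv, hy⟩, hxy⟩
    have h1 := hmin _ hdom'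
    rw [Finset.card_erase_of_mem hv] at h1
    omega
  obtain ⟨w, hvw⟩ := hnb v
  have hw : w ∉ Γ := fun h => hiso w h hvw
  obtain ⟨z, hz, hwz, hzv⟩ := hno w hw hvw.symm
  have hdom' : IsDominatingSet G (insert w (Γ.erase v)) := by
    intro x hx
    by_cases hxv : x = v
    · subst hxv
      exact ⟨w, Finset.mem_insert_self _ _, hvw⟩
    · have hx' : x ∉ Γ := fun h =>
        hx (Finset.mem_insert_of_mem (Finset.mem_erase.2 ⟨hxv, h⟩))
      obtain ⟨y, hy, hxy⟩ := hdom x hx'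
      by_cases hyv : y = v
      · subst hyv
        obtain ⟨z, hz, hxz, hzy⟩ := hno x hx' hxy
        exact ⟨z, Finset.mem_insert_of_mem (Finset.mem_erase.2 ⟨hzy, hz⟩), hxz⟩
      · exact ⟨y, Finset.mem_insert_of_mem (Finset.mem_erase.2 ⟨hyv, hy⟩), hxy⟩
  have hcard' : (insert w (Γ.erase v)).card = Γ₀.card := by
    rw [Finset.card_insert_of_notMem (fun h => hw (Finset.mem_of_mem_erase h)),
      Finset.card_erase_of_mem hv]
    omega
  have hle := hmax _ ⟨hdom', hcard'⟩
  have hsub : insert w (P Γ) ⊆ P (insert w (Γ.erase v)) := by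
    intro x hx
    rcases Finset.mem_insert.1 hx with rfl | hx
    · exact Finset.mem_filter.2 ⟨Finset.mem_insert_self _ _, z,
        Finset.mem_insert_of_mem (Finset.mem_erase.2 ⟨hzv, hz⟩), hwz⟩
    · obtain ⟨hxΓ, u, hu, hxu⟩ := Finset.mem_filter.1 hx
      have hxv : x ≠ v := by rintro rfl; exact hiso u hu hxu
      have huv : u ≠ v := by rintro rfl; exact hiso x hxΓ hxu.symm
      exact Finset.mem_filter.2 ⟨Finset.mem_insert_of_mem (Finset.mem_erase.2 ⟨hxv, hxΓ⟩), u,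
        Finset.mem_insert_of_mem (Finset.mem_erase.2 ⟨huv, hu⟩), hxu⟩
  have h2 := Finset.card_le_card hsub
  have hwP : w ∉ P Γ := fun h => hw (Finset.mem_filter.1 h).1
  rw [Finset.card_insert_of_notMem hwP] at h2
  omega

/-- If `G` is connected of order `n` with nonincreasing degree sequence
`d₁ ≥ ⋯ ≥ dₙ`, then `β(G) ≤ n - min {k : k + (d₁ + ⋯ + d_k) ≥ n}`. (Here
`d 0, d 1, …, d (n-1)` lists the degrees of `G` in nonincreasing order.) -/
theorem metricDimension_le_card_sub_sInf_of_degree_sequence [Fintype V]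
    (G : SimpleGraph V) [DecidableRel G.Adj] (hG : G.Connected) (d : ℕ → ℕ)
    (hsorted : ∀ i j : ℕ, i ≤ j → j < Fintype.card V → d j ≤ d i)
    (hdeg : ∃ σ : Fin (Fintype.card V) ≃ V, ∀ i : Fin (Fintype.card V), d i = G.degree (σ i)) :
    metricDimension G ≤
      Fintype.card V - sInf {k : ℕ | Fintype.card V ≤ k + ∑ i ∈ Finset.range k, d i} := by
  classical
  rcases subsingleton_or_nontrivial V with hs | hn
  · have : metricDimension G ≤ 0 :=
      Nat.sInf_le ⟨∅, fun u v huv => absurd (Subsingleton.elim u v) huv, rfl⟩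
    omega
  · have hnb : ∀ v, ∃ w, G.Adj v w := fun v =>
      (G.degree_pos_iff_exists_adj v).1 (hG.preconnected.degree_pos_of_nontrivial v)
    obtain ⟨Γ, hdom, hpriv⟩ := exists_dominating_private G hnb
    have h1 : sInf {k : ℕ | Fintype.card V ≤ k + ∑ i ∈ Finset.range k, d i} ≤ Γ.card :=
      Nat.sInf_le (card_le_of_dominating G d hsorted hdeg Γ hdom)
    have h2 : metricDimension G ≤ Fintype.card V - Γ.card := by
      refine Nat.sInf_le ⟨Γᶜ, ?_, Finset.card_compl Γ⟩
      intro u v huv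
      by_cases hu : u ∈ Γ
      · by_cases hv : v ∈ Γ
        · obtain ⟨w, hw, hwu, hp⟩ := hpriv u hu
          refine ⟨w, Finset.mem_compl.2 hw, fun h => huv ?_⟩
          rw [SimpleGraph.dist_eq_one_iff_adj.2 hwu.symm] at h
          exact (hp v hv (SimpleGraph.dist_eq_one_iff_adj.1 h.symm).symm).symm
        · refine ⟨v, Finset.mem_compl.2 hv, fun h => huv ?_⟩
          rw [SimpleGraph.dist_self] at h
          exact hG.dist_eq_zero_iff.1 h
      · refine ⟨u, Finset.mem_compl.2 hu, fun h => huv ?_⟩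
        rw [SimpleGraph.dist_self] at h
        exact (hG.dist_eq_zero_iff.1 h.symm).symm
    omega
end
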